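/- Let d : ℕ → ℕ satisfy d i ≥ 2 for all i, let V be the vertex set of the spherically homogeneous rooted tree with branching sequence d, and let G be a group acting on V by rooted-tree automorphisms. Let F ⊆ G be a finite subset such that every vertex of V is fixed by at least one element of F. Then there exist a vertex v₀ ∈ V and an element g ∈ F which fixes the entire subtree rooted at v₀, i.e. g • w = w for every w with v₀ ≼ w. -/

import Mathlib

/-- Vertex set of the spherically homogeneous rooted tree with branching sequence `d`:
a vertex of level `n` is a word `x : Π i : Fin n, Fin (d i)`. -/
def TreeVertex (d : ℕ → ℕ) : Type := Σ n : ℕ, (∀ i : Fin n, Fin (d i))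

/-- `IsAncestor v w` : the vertex `v` is an ancestor of `w` (i.e. `w` belongs to the
subtree rooted at `v`). -/
def IsAncestor {d : ℕ → ℕ} (v w : TreeVertex d) : Prop :=
  ∃ h : v.1 ≤ w.1, ∀ i : Fin v.1, v.2 i = w.2 (Fin.castLE h i)

theorem IsAncestor.rfl {d : ℕ → ℕ} (v : TreeVertex d) : IsAncestor v v :=
  ⟨le_rfl, fun _ => by simp⟩

theorem IsAncestor.trans {d : ℕ → ℕ} {u v w : TreeVertex d}
    (huv : IsAncestor u v) (hvw : IsAncestor v w) : IsAncestor u w := by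
  obtain ⟨h₁, e₁⟩ := huv
  obtain ⟨h₂, e₂⟩ := hvw
  exact ⟨h₁.trans h₂, fun i => (e₁ i).trans (e₂ (Fin.castLE h₁ i))⟩

/-- Two ancestors of the same vertex that lie on the same level coincide. -/
theorem IsAncestor.eq_of_level_eq {d : ℕ → ℕ} {u v w : TreeVertex d}
    (huw : IsAncestor u w) (hvw : IsAncestor v w) (huv : u.1 = v.1) : u = v := by
  obtain ⟨n, x⟩ := u
  obtain ⟨m, y⟩ := v
  obtain rfl : n = m := huv
  obtain ⟨_, e₁⟩ := huw
  obtain ⟨_, e₂⟩ := hvw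
  have hxy : x = y := funext fun i => (e₁ i).trans (e₂ i).symm
  rw [hxy]

/-- If every vertex below `v` is fixed by some element of the finite set `F`, then some
element of `F` fixes an entire subtree pointwise. -/
theorem exists_subtree_fixed_of_forall_descendant_fixed {d : ℕ → ℕ}
    {G : Type*} [Group G] [MulAction G (TreeVertex d)]
    (hlevel : ∀ (g : G) (v : TreeVertex d), (g • v).1 = v.1)
    (hanc : ∀ (g : G) (v w : TreeVertex d), IsAncestor v w → IsAncestor (g • v) (g • w))
    (F : Finset G) (v : TreeVertex d)
    (hfix : ∀ w, IsAncestor v w → ∃ g ∈ F, g • w = w) :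
    ∃ v₀ : TreeVertex d, ∃ g ∈ F, ∀ w, IsAncestor v₀ w → g • w = w := by
  classical
  induction F using Finset.induction_on generalizing v with
  | empty =>
    obtain ⟨g, hg, _⟩ := hfix v (IsAncestor.rfl v)
    simp at hg
  | insert g F _ ih =>
    by_cases hg : ∀ w, IsAncestor v w → g • w = w
    · exact ⟨v, g, Finset.mem_insert_self g F, hg⟩
    · push Not at hg
      obtain ⟨w, hvw, hgw⟩ := hg
      obtain ⟨v₀, k, hk, hfixk⟩ := ih w fun u hwu => by
        obtain ⟨k, hk, hku⟩ := hfix u (hvw.trans hwu)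
        rcases Finset.mem_insert.mp hk with rfl | hk
        · have hku' := hanc k w u hwu
          rw [hku] at hku'
          exact absurd (hku'.eq_of_level_eq hwu (hlevel k w)) hgw
        · exact ⟨k, hk, hku⟩
      exact ⟨v₀, k, Finset.mem_insert_of_mem hk, hfixk⟩

/-- If every vertex of the tree is fixed by at least one element of a finite set
`F ⊆ G`, then some element of `F` fixes an entire subtree pointwise. -/
theorem exists_subtree_fixed_of_no_free_vertex
    (d : ℕ → ℕ) (hd : ∀ i, 2 ≤ d i)
    (G : Type*) [Group G] [MulAction G (TreeVertex d)]
    (hlevel : ∀ (g : G) (v : TreeVertex d), (g • v).1 = v.1)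
    (hanc : ∀ (g : G) (v w : TreeVertex d), IsAncestor v w → IsAncestor (g • v) (g • w))
    (F : Finset G) (hfix : ∀ v : TreeVertex d, ∃ g ∈ F, g • v = v) :
    ∃ v₀ : TreeVertex d, ∃ g ∈ F, ∀ w, IsAncestor v₀ w → g • w = w := by
  exact exists_subtree_fixed_of_forall_descendant_fixed hlevel hanc F ⟨0, fun i => i.elim0⟩
    fun w _ => hfix w
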